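/- The session-merging transformation preserves structural congruence: for any choreographies C and C' of the Global Calculus and any session channel name k, if C ≡ C' then [[C]]_k ≡ [[C']]_k, where ≡ is the structural congruence of GC handling alpha-renaming of bound names and unfolding of recursive calls (rec X. C ≡ C[rec X. C / X]). -/

import Mathlib

/-!
The Global Calculus (GC) of Carbone & Montesi, "Merging Multiparty Protocols in
Multiparty Choreographies".

Names (threads, roles, public channels, session channels, variables, labels,
recursion variables) are represented as strings.
-/

/-- Values (results of evaluating first-order expressions). -/
inductive Value where
  | bool : Bool → Value
  | int : Int → Value
  | str : String → Value
deriving DecidableEq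

/-- First-order expressions: values and variables. -/
inductive Expr where
  | val : Value → Expr
  | var : String → Expr
deriving DecidableEq

/-- Evaluation of expressions to values, `e ↓ v`. -/
inductive Eval : Expr → Value → Prop where
  | val (v : Value) : Eval (.val v) v

/-- Interactions `η`:
* `start ts a k` is `start τ₁[p₁],…,τₙ[pₙ] : a(k)` where `ts = [(τ₁,p₁),…,(τₙ,pₙ)]`
  (the session channel `k` is bound in the continuation of the enclosing `seq`);
* `com τ₁ p₁ e τ₂ p₂ x k` is `τ₁[p₁].e → τ₂[p₂].x : k`
  (the variable `x` is bound in the continuation of the enclosing `seq`);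
* `sel τ₁ p₁ τ₂ p₂ k l` is `τ₁[p₁] → τ₂[p₂] : k[l]`. -/
inductive Eta where
  | start : List (String × String) → String → String → Eta
  | com : String → String → Expr → String → String → String → String → Eta
  | sel : String → String → String → String → String → String → Eta
deriving DecidableEq

/-- Choreographies `C ::= η;C | if e@τ then C₁ else C₂ | rec X. C | X | (ν k) C | 0`. -/
inductive Chor where
  | seq : Eta → Chor → Chor
  | cond : String → Expr → Chor → Chor → Chor
  | recC : String → Chor → Chor
  | call : String → Chor
  | res : String → Chor → Chor
  | nil : Chor
deriving DecidableEq

namespace Chor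

/-! ### Substitution of values for variables -/

/-- Substitution of value `v` for variable `x` in an expression. -/
def substE (x : String) (v : Value) : Expr → Expr
  | .val w => .val w
  | .var y => if y = x then .val v else .var y

/-- Substitution of value `v` for variable `x` in an interaction prefix. -/
def substEta (x : String) (v : Value) : Eta → Eta
  | .start ts a k => .start ts a k
  | .com t1 p1 e t2 p2 y k => .com t1 p1 (substE x v e) t2 p2 y k
  | .sel t1 p1 t2 p2 k l => .sel t1 p1 t2 p2 k l

/-- Capture-avoiding substitution `C[v/x]` of the (closed) value `v` for the
variable `x` in the choreography `C`; the binder of a communication shadows. -/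
def substV (x : String) (v : Value) : Chor → Chor
  | .seq (.com t1 p1 e t2 p2 y k) C =>
      .seq (.com t1 p1 (substE x v e) t2 p2 y k)
        (if y = x then C else substV x v C)
  | .seq η C => .seq (substEta x v η) (substV x v C)
  | .cond t e C1 C2 => .cond t (substE x v e) (substV x v C1) (substV x v C2)
  | .recC X C => .recC X (substV x v C)
  | .call X => .call X
  | .res k C => .res k (substV x v C)
  | .nil => .nil

/-- Substitution `C[D/X]` of the choreography `D` for the recursion variable `X`. -/
def substX (X : String) (D : Chor) : Chor → Chor
  | .seq η C => .seq η (substX X D C)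
  | .cond t e C1 C2 => .cond t e (substX X D C1) (substX X D C2)
  | .recC Y C => if Y = X then .recC Y C else .recC Y (substX X D C)
  | .call Y => if Y = X then D else .call Y
  | .res k C => .res k (substX X D C)
  | .nil => .nil

/-! ### Name swapping (for alpha-renaming) and free names -/

/-- Swap the names `a` and `b`. -/
def swapN (a b s : String) : String := if s = a then b else if s = b then a else s

/-- Swap session channel names `a` and `b` in an interaction. -/
def swapKEta (a b : String) : Eta → Eta
  | .start ts c k => .start ts c (swapN a b k)
  | .com t1 p1 e t2 p2 x k => .com t1 p1 e t2 p2 x (swapN a b k)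
  | .sel t1 p1 t2 p2 k l => .sel t1 p1 t2 p2 (swapN a b k) l

/-- Swap session channel names `a` and `b` in a choreography. -/
def swapK (a b : String) : Chor → Chor
  | .seq η C => .seq (swapKEta a b η) (swapK a b C)
  | .cond t e C1 C2 => .cond t e (swapK a b C1) (swapK a b C2)
  | .recC X C => .recC X (swapK a b C)
  | .call X => .call X
  | .res k C => .res (swapN a b k) (swapK a b C)
  | .nil => .nil

/-- Swap variable names `a` and `b` in an expression. -/
def swapVE (a b : String) : Expr → Expr
  | .val w => .val w
  | .var y => .var (swapN a b y)

/-- Swap variable names `a` and `b` in an interaction. -/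
def swapVEta (a b : String) : Eta → Eta
  | .start ts c k => .start ts c k
  | .com t1 p1 e t2 p2 x k => .com t1 p1 (swapVE a b e) t2 p2 (swapN a b x) k
  | .sel t1 p1 t2 p2 k l => .sel t1 p1 t2 p2 k l

/-- Swap variable names `a` and `b` in a choreography. -/
def swapV (a b : String) : Chor → Chor
  | .seq η C => .seq (swapVEta a b η) (swapV a b C)
  | .cond t e C1 C2 => .cond t (swapVE a b e) (swapV a b C1) (swapV a b C2)
  | .recC X C => .recC X (swapV a b C)
  | .call X => .call X
  | .res k C => .res k (swapV a b C)
  | .nil => .nil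

/-- Swap recursion variable names `a` and `b` in a choreography. -/
def swapX (a b : String) : Chor → Chor
  | .seq η C => .seq η (swapX a b C)
  | .cond t e C1 C2 => .cond t e (swapX a b C1) (swapX a b C2)
  | .recC X C => .recC (swapN a b X) (swapX a b C)
  | .call X => .call (swapN a b X)
  | .res k C => .res k (swapX a b C)
  | .nil => .nil

/-- Free session channel names of a choreography. -/
def freeK : Chor → List String
  | .seq (.start _ _ k) C => (freeK C).filter (· ≠ k)
  | .seq (.com _ _ _ _ _ _ k) C => k :: freeK C
  | .seq (.sel _ _ _ _ k _) C => k :: freeK C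
  | .cond _ _ C1 C2 => freeK C1 ++ freeK C2
  | .recC _ C => freeK C
  | .call _ => []
  | .res k C => (freeK C).filter (· ≠ k)
  | .nil => []

/-- Free variables of an expression. -/
def freeVE : Expr → List String
  | .val _ => []
  | .var y => [y]

/-- Free variables of a choreography. -/
def freeV : Chor → List String
  | .seq (.com _ _ e _ _ x _) C => freeVE e ++ (freeV C).filter (· ≠ x)
  | .seq _ C => freeV C
  | .cond _ e C1 C2 => freeVE e ++ freeV C1 ++ freeV C2
  | .recC _ C => freeV C
  | .call _ => []
  | .res _ C => freeV C
  | .nil => []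

/-- Free recursion variables of a choreography. -/
def freeX : Chor → List String
  | .seq _ C => freeX C
  | .cond _ _ C1 C2 => freeX C1 ++ freeX C2
  | .recC X C => (freeX C).filter (· ≠ X)
  | .call X => [X]
  | .res _ C => freeX C
  | .nil => []

/-! ### Structural congruence -/

/-- Structural congruence `≡`: the smallest congruence on choreographies
containing alpha-equivalence (renaming of bound session channels, bound
variables and bound recursion variables) and the unfolding of recursive calls
`rec X. C ≡ C[rec X. C / X]`. -/
inductive Cong : Chor → Chor → Prop where
  | refl (C) : Cong C C
  | symm : Cong C C' → Cong C' C
  | trans : Cong C1 C2 → Cong C2 C3 → Cong C1 C3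
  | unfold (X C) : Cong (.recC X C) (substX X (.recC X C) C)
  | alphaRes : k' ∉ freeK C → Cong (.res k C) (.res k' (swapK k k' C))
  | alphaStart : k' ∉ freeK C →
      Cong (.seq (.start ts a k) C) (.seq (.start ts a k') (swapK k k' C))
  | alphaCom : x' ∉ freeV C →
      Cong (.seq (.com t1 p1 e t2 p2 x k) C)
        (.seq (.com t1 p1 e t2 p2 x' k) (swapV x x' C))
  | alphaRec : X' ∉ freeX C → Cong (.recC X C) (.recC X' (swapX X X' C))
  | seqCong : Cong C C' → Cong (.seq η C) (.seq η C')
  | condCong : Cong C1 C1' → Cong C2 C2' →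
      Cong (.cond t e C1 C2) (.cond t e C1' C2')
  | recCong : Cong C C' → Cong (.recC X C) (.recC X C')
  | resCong : Cong C C' → Cong (.res k C) (.res k C')

/-! ### Reduction semantics -/

/-- The reduction relation `C → C'` of the Global Calculus. -/
inductive Red : Chor → Chor → Prop where
  | start (ts a k C) : Red (.seq (.start ts a k) C) (.res k C)
  | com : Eval e v →
      Red (.seq (.com t1 p1 e t2 p2 x k) C) (substV x v C)
  | sel (t1 p1 t2 p2 k l C) : Red (.seq (.sel t1 p1 t2 p2 k l) C) C
  | iftrue : Eval e (.bool true) → Red (.cond t e C1 C2) C1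
  | iffalse : Eval e v → v ≠ .bool true → Red (.cond t e C1 C2) C2
  | recCtx : Red C C' → Red (.recC X C) (.recC X C')
  | resCtx : Red C C' → Red (.res k C) (.res k C')
  | struct : Cong C1 C1' → Red C1' C2' → Cong C2' C2 → Red C1 C2

/-! ### The session-merging transformation -/

/-- The transformation `[[C]]_k` merging all the sessions of `C` into the
single session `k`: start terms (and restrictions) are removed, and in every
in-session interaction each thread's role annotation is replaced by the thread
name itself and the session channel by `k`. -/
def merge (k : String) : Chor → Chor
  | .seq (.start _ _ _) C => merge k C
  | .seq (.com t1 _ e t2 _ x _) C => .seq (.com t1 t1 e t2 t2 x k) (merge k C)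
  | .seq (.sel t1 _ t2 _ _ l) C => .seq (.sel t1 t1 t2 t2 k l) (merge k C)
  | .cond t e C1 C2 => .cond t e (merge k C1) (merge k C2)
  | .recC X C => .recC X (merge k C)
  | .call X => .call X
  | .res _ C => merge k C
  | .nil => .nil

/-- The list of session channels started in a choreography. -/
def startedChans : Chor → List String
  | .seq (.start _ _ k) C => k :: startedChans C
  | .seq _ C => startedChans C
  | .cond _ _ C1 C2 => startedChans C1 ++ startedChans C2
  | .recC _ C => startedChans C
  | .call _ => []
  | .res _ C => startedChans C
  | .nil => []

/-- All session channels started in `C` are pairwise distinct: no two start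
subterms of `C` bind the same session channel. -/
def DistinctStarts (C : Chor) : Prop := (startedChans C).Nodup

end Chor

namespace Chor

theorem merge_substX (k X : String) (D C : Chor) :
    merge k (substX X D C) = substX X (merge k D) (merge k C) := by
  induction C with
  | seq η C ih => cases η <;> simp [merge, substX, ih]
  | cond t e C₁ C₂ ih₁ ih₂ => simp [merge, substX, ih₁, ih₂]
  | recC Y C ih => by_cases h : Y = X <;> simp [merge, substX, h, ih]
  | call Y => by_cases h : Y = X <;> simp [merge, substX, h]
  | res k' C ih => simpa [merge, substX] using ih
  | nil => rfl

theorem merge_swapK (k a b : String) (C : Chor) : merge k (swapK a b C) = merge k C := by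
  induction C with
  | seq η C ih => cases η <;> simp [merge, swapK, swapKEta, ih]
  | _ => simp_all [merge, swapK]

theorem merge_swapV (k a b : String) (C : Chor) :
    merge k (swapV a b C) = swapV a b (merge k C) := by
  induction C with
  | seq η C ih => cases η <;> simp [merge, swapV, swapVEta, ih]
  | _ => simp_all [merge, swapV]

theorem merge_swapX (k a b : String) (C : Chor) :
    merge k (swapX a b C) = swapX a b (merge k C) := by
  induction C with
  | seq η C ih => cases η <;> simp [merge, swapX, ih]
  | _ => simp_all [merge, swapX]

theorem freeV_merge (k : String) (C : Chor) : freeV (merge k C) = freeV C := by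
  induction C with
  | seq η C ih => cases η <;> simp [merge, freeV, ih]
  | _ => simp_all [merge, freeV]

theorem freeX_merge (k : String) (C : Chor) : freeX (merge k C) = freeX C := by
  induction C with
  | seq η C ih => cases η <;> simp [merge, freeX, ih]
  | _ => simp_all [merge, freeX]

end Chor

open Chor in
/-- **The session-merging transformation preserves structural congruence.**
For any choreographies `C`, `C'` and session channel name `k`, if `C ≡ C'`
then `[[C]]_k ≡ [[C']]_k`. -/
theorem merge_cong (C C' : Chor) (k : String) (h : Cong C C') :
    Cong (merge k C) (merge k C') := by
  induction h with
  | refl C => exact .refl _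
  | symm _ ih => exact .symm ih
  | trans _ _ ih₁ ih₂ => exact .trans ih₁ ih₂
  | unfold X C =>
    rw [merge_substX]
    exact .unfold X (merge k C)
  | alphaRes _ =>
    simp only [merge, merge_swapK]
    exact .refl _
  | alphaStart _ =>
    simp only [merge, merge_swapK]
    exact .refl _
  | alphaCom hx =>
    simp only [merge, merge_swapV]
    exact .alphaCom (by rwa [freeV_merge])
  | alphaRec hX =>
    simp only [merge, merge_swapX]
    exact .alphaRec (by rwa [freeX_merge])
  | @seqCong _ _ η _ ih =>
    cases η with
    | start => exact ih
    | com => exact .seqCong ih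
    | sel => exact .seqCong ih
  | condCong _ _ ih₁ ih₂ => exact .condCong ih₁ ih₂
  | recCong _ ih => exact .recCong ih
  | resCong _ ih => exact ih
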